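/- Let (Ω, 𝔉, P) be a probability space, N ≥ 1, let (W_n)_{n∈ℕ} be a sequence of random vectors W_n : Ω → ℝ^N, let (a_n)_{n∈ℕ} be a sequence of positive real numbers, and let Σ ∈ ℝ^{N×N} be symmetric positive semidefinite. Assume that for every x ∈ ℝ^N with x ≠ 0, P-almost surely limsup_{n→∞} a_n ⟨x, W_n⟩ = sqrt(2 · x^T Σ x). Then P-almost surely limsup_{n→∞} a_n ‖W_n‖ = sqrt(2 · λ_max(Σ)), where ‖·‖ is the Euclidean norm and λ_max(Σ) is the largest eigenvalue of Σ. -/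

import Mathlib

open Matrix MeasureTheory

open Filter Topology WithLp

open scoped RealInnerProductSpace

section InnerProductSpace

variable {E : Type*} [NormedAddCommGroup E] [InnerProductSpace ℝ E]

/-- A sequence whose inner products with all vectors of an orthonormal basis and with their
negatives are eventually bounded above is eventually bounded in norm. -/
lemma isBoundedUnder_norm_of_orthonormalBasis {ι : Type*} [Fintype ι]
    (b : OrthonormalBasis ι ℝ E) {u : ℕ → E}
    (hpos : ∀ i, IsBoundedUnder (· ≤ ·) atTop fun n => ⟪b i, u n⟫)
    (hneg : ∀ i, IsBoundedUnder (· ≤ ·) atTop fun n => ⟪-b i, u n⟫) :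
    IsBoundedUnder (· ≤ ·) atTop fun n => ‖u n‖ := by
  have habs : ∀ i ∈ Finset.univ, IsBoundedUnder (· ≤ ·) atTop fun n => |⟪b i, u n⟫| := fun i _ =>
    isBoundedUnder_le_abs.2 ⟨hpos i, by simpa [inner_neg_left] using hneg i⟩
  refine (isBoundedUnder_le_sum Finset.univ habs).mono_le (.of_forall fun n => ?_)
  calc ‖u n‖ = ‖∑ i, ⟪b i, u n⟫ • b i‖ := by rw [b.sum_repr']
    _ ≤ ∑ i, ‖⟪b i, u n⟫ • b i‖ := norm_sum_le _ _
    _ = (∑ i, fun n => |⟪b i, u n⟫|) n := by simp [norm_smul]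

lemma isBoundedUnder_abs_inner {u : ℕ → E}
    (hu : IsBoundedUnder (· ≤ ·) atTop fun n => ‖u n‖) (x : E) :
    IsBoundedUnder (· ≤ ·) atTop fun n => |⟪x, u n⟫| := by
  obtain ⟨C, hC⟩ := hu
  refine ⟨‖x‖ * C, ?_⟩
  rw [eventually_map] at hC ⊢
  filter_upwards [hC] with n hn
  exact (abs_real_inner_le_norm _ _).trans (by gcongr)

/-- If the upper limits of `⟪x, u n⟫` are at most `c * ‖x‖` for `x` in a dense set, and equal to
`c` for some unit vector, then `c` is the upper limit of `‖u n‖`, for a bounded sequence `u` in a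
finite-dimensional space. -/
lemma limsup_norm_eq_of_dense [FiniteDimensional ℝ E] {u : ℕ → E} {D : Set E} {c : ℝ} {v : E}
    (hu : IsBoundedUnder (· ≤ ·) atTop fun n => ‖u n‖) (hD : Dense D)
    (hle : ∀ x ∈ D, limsup (fun n => ⟪x, u n⟫) atTop ≤ c * ‖x‖)
    (hv : ‖v‖ = 1) (heq : limsup (fun n => ⟪v, u n⟫) atTop = c) :
    limsup (fun n => ‖u n‖) atTop = c := by
  have hinner := fun x => isBoundedUnder_le_abs.1 (isBoundedUnder_abs_inner hu x)
  apply le_antisymm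
  · by_contra! hlt
    obtain ⟨r, hcr, hr⟩ := exists_between hlt
    have hfreq : ∃ᶠ n in atTop, r < ‖u n‖ := frequently_lt_of_lt_limsup
      (isBoundedUnder_of ⟨0, fun n => norm_nonneg _⟩ :
        IsBoundedUnder (· ≥ ·) _ _).isCoboundedUnder_le hr
    obtain ⟨C, hC⟩ := hu
    rw [eventually_map] at hC
    have : ProperSpace E := FiniteDimensional.proper ℝ E
    have hcompact : IsCompact (Metric.closedBall (0 : E) C ∩ {x | r ≤ ‖x‖}) :=
      (isCompact_closedBall _ _).inter_right (isClosed_le continuous_const continuous_norm)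
    obtain ⟨w, ⟨-, hw⟩, φ, hφ, hlim⟩ := hcompact.tendsto_subseq' (x := u)
      ((hfreq.and_eventually hC).mono fun n hn => ⟨by simpa using hn.2, hn.1.le⟩)
    have hwD : ∀ x ∈ D, ⟪x, w⟫ ≤ c * ‖x‖ := by
      intro x hx
      refine le_of_forall_pos_le_add fun ε hε => ?_
      have hev := eventually_lt_of_limsup_lt
        (lt_of_le_of_lt (hle x hx) (lt_add_of_pos_right _ hε)) (hinner x).1
      have ht : Tendsto (fun k => ⟪x, u (φ k)⟫) atTop (𝓝 ⟪x, w⟫) :=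
        tendsto_const_nhds.inner hlim
      exact le_of_tendsto ht ((hφ.tendsto_atTop.eventually hev).mono fun _ h => h.le)
    have hwE : ∀ x, ⟪x, w⟫ ≤ c * ‖x‖ := fun x =>
      (isClosed_le (by fun_prop) (by fun_prop) :
        IsClosed {x : E | ⟪x, w⟫ ≤ c * ‖x‖}).closure_subset_iff.2 hwD (hD x)
    have hc : 0 ≤ c := by
      have hv0 := hwE v
      have hv1 := hwE (-v)
      rw [inner_neg_left, norm_neg] at hv1
      rw [hv] at hv0 hv1
      linarith
    have hww := hwE w
    rw [real_inner_self_eq_norm_sq] at hww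
    have hw' : r ≤ ‖w‖ := hw
    nlinarith
  · rw [← heq]
    refine limsup_le_limsup (.of_forall fun n => ?_) (hinner v).2.isCoboundedUnder_le hu
    simpa [hv] using real_inner_le_norm v (u n)

end InnerProductSpace

section Matrix

variable {ι : Type*} [Fintype ι] {A : Matrix ι ι ℝ}

/-- Expansion of the quadratic form of a symmetric matrix along an eigenvector. -/
lemma Matrix.IsHermitian.dotProduct_mulVec_add_smul (hA : A.IsHermitian) {v : ι → ℝ} {l : ℝ}
    (hv : A *ᵥ v = l • v) (w : ι → ℝ) (t : ℝ) :
    (w + t • v) ⬝ᵥ (A *ᵥ (w + t • v)) =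
      w ⬝ᵥ (A *ᵥ w) + 2 * t * l * (w ⬝ᵥ v) + t ^ 2 * l * (v ⬝ᵥ v) := by
  have hT : Aᵀ = A := by simpa using hA.eq
  have hvw : v ⬝ᵥ (A *ᵥ w) = l * (w ⬝ᵥ v) := by
    rw [dotProduct_mulVec, ← mulVec_transpose, hT, hv, smul_dotProduct, dotProduct_comm, smul_eq_mul]
  simp only [mulVec_add, mulVec_smul, hv, add_dotProduct, dotProduct_add, smul_dotProduct,
    dotProduct_smul, smul_eq_mul, hvw]
  ring

variable [DecidableEq ι]

/-- The quadratic form of a symmetric matrix is bounded by its largest eigenvalue. -/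
lemma Matrix.IsHermitian.dotProduct_mulVec_le (hA : A.IsHermitian) (x : ι → ℝ) :
    x ⬝ᵥ (A *ᵥ x) ≤ sSup (spectrum ℝ A) * (x ⬝ᵥ x) := by
  have hps : (algebraMap ℝ (Matrix ι ι ℝ) (sSup (spectrum ℝ A)) - A).PosSemidef := by
    rw [posSemidef_iff_isHermitian_and_spectrum_nonneg]
    refine ⟨IsHermitian.sub ?_ hA, ?_⟩
    · rw [Algebra.algebraMap_eq_smul_one, IsHermitian, conjTranspose_smul]
      simp
    · rw [← spectrum.singleton_sub_eq]
      rintro _ ⟨_, rfl, y, hy, rfl⟩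
      exact sub_nonneg.2 (le_csSup A.finite_real_spectrum.bddAbove hy)
  have h := hps.dotProduct_mulVec_nonneg x
  rw [Algebra.algebraMap_eq_smul_one, sub_mulVec, smul_mulVec, one_mulVec, dotProduct_sub,
    dotProduct_smul] at h
  simpa using h

/-- The largest eigenvalue of a symmetric matrix is attained at a unit vector. -/
lemma Matrix.IsHermitian.exists_norm_eq_one_mulVec_eq [Nonempty ι] (hA : A.IsHermitian) :
    ∃ v : EuclideanSpace ℝ ι, ‖v‖ = 1 ∧ A *ᵥ ofLp v = sSup (spectrum ℝ A) • ofLp v := by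
  have hne : (spectrum ℝ A).Nonempty := by
    rw [hA.spectrum_real_eq_range_eigenvalues]
    exact Set.range_nonempty _
  have hmem := hne.csSup_mem A.finite_real_spectrum
  rw [hA.spectrum_real_eq_range_eigenvalues] at hmem
  obtain ⟨j, hj⟩ := hmem
  refine ⟨hA.eigenvectorBasis j, hA.eigenvectorBasis.norm_eq_one j, ?_⟩
  rw [hA.mulVec_eigenvectorBasis, hj, hA.spectrum_real_eq_range_eigenvalues]

end Matrix

/-- A real sequence with nonzero upper limit is eventually bounded above. -/
lemma isBoundedUnder_of_limsup_ne_zero {f : ℕ → ℝ} (hf : limsup f atTop ≠ 0) :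
    IsBoundedUnder (· ≤ ·) atTop f := by
  by_contra h
  exact hf (Real.limsup_of_not_isBoundedUnder h)

/-- The deterministic transfer of upper limits from linear functionals to the norm. The vectors
`±e i + 3 • v` and `-3 • v` force boundedness of the sequence as soon as `A ≠ 0`. -/
lemma limsup_norm_eq_sqrt_of_limsup_inner {ι : Type*} [Fintype ι] [DecidableEq ι]
    {A : Matrix ι ι ℝ} (hA : A.PosSemidef) {v : EuclideanSpace ℝ ι} (hv : ‖v‖ = 1)
    (hAv : A *ᵥ ofLp v = sSup (spectrum ℝ A) • ofLp v)
    {D : Set (EuclideanSpace ℝ ι)} (hD : Dense D) (hvD : v ∈ D) (hvD' : (-3 : ℝ) • v ∈ D)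
    (hpos : ∀ i, EuclideanSpace.basisFun ι ℝ i + (3 : ℝ) • v ∈ D)
    (hneg : ∀ i, -EuclideanSpace.basisFun ι ℝ i + (3 : ℝ) • v ∈ D)
    {u : ℕ → EuclideanSpace ℝ ι}
    (hu : ∀ x ∈ D, limsup (fun n => ⟪x, u n⟫) atTop =
      √(2 * (ofLp x ⬝ᵥ (A *ᵥ ofLp x)))) :
    limsup (fun n => ‖u n‖) atTop = √(2 * sSup (spectrum ℝ A)) := by
  set l := sSup (spectrum ℝ A)
  have hdot : ∀ x : EuclideanSpace ℝ ι, ofLp x ⬝ᵥ ofLp x = ‖x‖ ^ 2 := fun x => by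
    rw [← real_inner_self_eq_norm_sq]; rfl
  have hqv : ofLp v ⬝ᵥ (A *ᵥ ofLp v) = l := by
    rw [hAv, dotProduct_smul, hdot, hv]; simp
  have hl0 : 0 ≤ l := by
    rw [← hqv]; simpa using hA.dotProduct_mulVec_nonneg (ofLp v)
  have hlim (hbdd : IsBoundedUnder (· ≤ ·) atTop fun n => ‖u n‖) :
      limsup (fun n => ‖u n‖) atTop = √(2 * l) := by
    refine limsup_norm_eq_of_dense hbdd hD (fun x hx => ?_) hv (by rw [hu v hvD, hqv])
    rw [hu x hx, ← Real.sqrt_sq (norm_nonneg x), ← Real.sqrt_mul (by positivity), ← hdot]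
    apply Real.sqrt_le_sqrt
    linarith [hA.1.dotProduct_mulVec_le (ofLp x)]
  rcases hl0.eq_or_lt with h0 | h0
  · by_cases hbdd : IsBoundedUnder (· ≤ ·) atTop fun n => ‖u n‖
    · exact hlim hbdd
    · rw [Real.limsup_of_not_isBoundedUnder hbdd, ← h0]; simp
  have hbd {x : EuclideanSpace ℝ ι} (hx : x ∈ D) (hq : 0 < ofLp x ⬝ᵥ (A *ᵥ ofLp x)) :
      IsBoundedUnder (· ≤ ·) atTop fun n => ⟪x, u n⟫ := by
    refine isBoundedUnder_of_limsup_ne_zero ?_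
    rw [hu x hx]
    positivity
  have hbdv : IsBoundedUnder (· ≤ ·) atTop fun n => ⟪(-3 : ℝ) • v, u n⟫ := by
    refine hbd hvD' ?_
    rw [ofLp_smul, mulVec_smul, dotProduct_smul, smul_dotProduct, hqv]
    simp only [smul_eq_mul]
    linarith
  have hunit {w : EuclideanSpace ℝ ι} (hw : ‖w‖ = 1) (hwD : w + (3 : ℝ) • v ∈ D) :
      IsBoundedUnder (· ≤ ·) atTop fun n => ⟪w, u n⟫ := by
    have hq : 0 < ofLp (w + (3 : ℝ) • v) ⬝ᵥ (A *ᵥ ofLp (w + (3 : ℝ) • v)) := by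
      rw [ofLp_add, ofLp_smul, hA.1.dotProduct_mulVec_add_smul hAv, hdot, hv]
      have h1 : 0 ≤ ofLp w ⬝ᵥ (A *ᵥ ofLp w) := by
        simpa using hA.dotProduct_mulVec_nonneg (ofLp w)
      have h2 : -1 ≤ ofLp w ⬝ᵥ ofLp v := by
        have := (abs_le.1 (abs_real_inner_le_norm v w)).1
        rwa [hv, hw, one_mul] at this
      nlinarith
    convert isBoundedUnder_le_add (hbd hwD hq) hbdv using 2 with n
    simp only [Pi.add_apply, ← inner_add_left]
    congr 1
    module
  refine hlim (isBoundedUnder_norm_of_orthonormalBasis (EuclideanSpace.basisFun ι ℝ)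
    (fun i => hunit ?_ (hpos i)) (fun i => hunit ?_ (hneg i)))
  · exact OrthonormalBasis.norm_eq_one _ i
  · rw [norm_neg]; exact OrthonormalBasis.norm_eq_one _ i

/-- key step of Theorem 3.5: if for every `x ≠ 0` the scalar law of the
iterated logarithm `limsup aₙ ⟨x, Wₙ⟩ = sqrt(2 xᵀ Σ x)` holds almost surely, then almost surely
`limsup aₙ ‖Wₙ‖ = sqrt(2 λ_max(Σ))`, where `‖·‖` is the Euclidean norm and `λ_max(Σ)` is the
largest eigenvalue of the symmetric positive semidefinite matrix `Σ` (the `sSup` of its real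
spectrum). -/
theorem stmt_10 {Ω : Type*} [MeasurableSpace Ω] (P : Measure Ω) [IsProbabilityMeasure P]
    {N : ℕ} (hN : 1 ≤ N) (W : ℕ → Ω → Fin N → ℝ) (a : ℕ → ℝ) (ha : ∀ n, 0 < a n)
    (Sig : Matrix (Fin N) (Fin N) ℝ) (hSig : Sig.PosSemidef)
    (hlin : ∀ x : Fin N → ℝ, x ≠ 0 →
      ∀ᵐ ω ∂P, Filter.limsup (fun n => a n * (x ⬝ᵥ W n ω)) Filter.atTop =
        Real.sqrt (2 * (x ⬝ᵥ (Sig *ᵥ x)))) :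
    ∀ᵐ ω ∂P, Filter.limsup (fun n => a n * Real.sqrt (∑ i, (W n ω i) ^ 2)) Filter.atTop =
      Real.sqrt (2 * sSup (spectrum ℝ Sig)) := by
  have : Nonempty (Fin N) := ⟨⟨0, hN⟩⟩
  obtain ⟨v, hv, hSv⟩ := hSig.1.exists_norm_eq_one_mulVec_eq
  obtain ⟨D, hDc, hD⟩ := TopologicalSpace.exists_countable_dense (EuclideanSpace ℝ (Fin N))
  set e := EuclideanSpace.basisFun (Fin N) ℝ
  set D' := D ∪ ({v, (-3 : ℝ) • v} ∪ (Set.range (fun i => e i + (3 : ℝ) • v) ∪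
    Set.range (fun i => -e i + (3 : ℝ) • v)))
  have hDc' : D'.Countable := hDc.union ((Set.toFinite _).countable.union
    ((Set.countable_range _).union (Set.countable_range _)))
  have hae : ∀ᵐ ω ∂P, ∀ x ∈ D', limsup (fun n => a n * (ofLp x ⬝ᵥ W n ω)) atTop =
      √(2 * (ofLp x ⬝ᵥ (Sig *ᵥ ofLp x))) := by
    refine (ae_ball_iff hDc').2 fun x _ => ?_
    by_cases hx : ofLp x = 0
    · simp [hx]
    · exact hlin _ hx
  filter_upwards [hae] with ω hω
  have key := limsup_norm_eq_sqrt_of_limsup_inner hSig hv hSv (hD.mono Set.subset_union_left)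
    (.inr (.inl (.inl rfl))) (.inr (.inl (.inr rfl))) (fun i => .inr (.inr (.inl ⟨i, rfl⟩)))
    (fun i => .inr (.inr (.inr ⟨i, rfl⟩)))
    (u := fun n => a n • toLp 2 (W n ω)) (D := D') fun x hx => by
      rw [← hω x hx]
      congr with n
      rw [inner_smul_right, dotProduct_comm]
      rfl
  rw [← key]
  congr with n
  rw [norm_smul, Real.norm_of_nonneg (ha n).le, EuclideanSpace.norm_eq]
  simp
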